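/- Let (X,d) be a metric space with marked point p. If every pretangent space Ω_{p,r̃}^X is a Ptolemaic, Busemann convex geodesic metric space (i.e., a CAT(0) space by the Foertsch–Lytchak–Schroeder characterization), then X is Busemann convex at p and liminf_{w,x,y,z→p} A₃(w,x,y,z) ≥ 0. -/

import Mathlib

open Filter Topology

universe u

section Defs

variable {X : Type u} [MetricSpace X]

/-- A normalizing sequence is a sequence of positive reals tending to zero. -/
def IsNormalizingSeq (r : ℕ → ℝ) : Prop :=
  (∀ n, 0 < r n) ∧ Tendsto r atTop (𝓝 0)

/-- Two sequences of points of `X` are mutually stable w.r.t. `r` if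
`d(x_n, y_n)/r_n` converges to a finite limit. -/
def MutuallyStable (r : ℕ → ℝ) (x y : ℕ → X) : Prop :=
  ∃ L : ℝ, Tendsto (fun n => dist (x n) (y n) / r n) atTop (𝓝 L)

/-- A family of sequences is self-stable if any two members are mutually stable. -/
def SelfStable (r : ℕ → ℝ) (F : Set (ℕ → X)) : Prop :=
  ∀ x ∈ F, ∀ y ∈ F, MutuallyStable r x y

/-- A maximal self-stable family containing the constant sequence `p`. -/
def MaximalSelfStable (p : X) (r : ℕ → ℝ) (F : Set (ℕ → X)) : Prop :=
  SelfStable r F ∧ (fun _ => p) ∈ F ∧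
    ∀ G : Set (ℕ → X), SelfStable r G → F ⊆ G → G = F

/-- `(Ω, π)` is (a realization of) the pretangent space of `X` at `p`
with respect to the normalizing sequence `r` and the maximal self-stable family
`F`; the map `π` is the metric identification projection, so that the distance
in `Ω` between `π x` and `π y` is `lim_n d(x_n,y_n)/r_n`. -/
def IsPretangentSpace (p : X) (r : ℕ → ℝ) (F : Set (ℕ → X))
    {Ω : Type u} [MetricSpace Ω] (π : (ℕ → X) → Ω) : Prop :=
  IsNormalizingSeq r ∧ MaximalSelfStable p r F ∧
    (∀ ω : Ω, ∃ x ∈ F, π x = ω) ∧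
    ∀ x ∈ F, ∀ y ∈ F,
      Tendsto (fun n => dist (x n) (y n) / r n) atTop (𝓝 (dist (π x) (π y)))

/-- The pretangent space determined by the maximal self-stable family `F` is
tangent: for every strictly increasing sequence `φ` of naturals and every
maximal self-stable family `F'` w.r.t. `r ∘ φ` containing all `x ∘ φ` with
`x ∈ F`, the canonical isometric embedding `em'` is bijective (being always an
isometric embedding it suffices that it be surjective, as stated here). -/
def IsTangentFamily (p : X) (r : ℕ → ℝ) (F : Set (ℕ → X)) : Prop :=
  ∀ φ : ℕ → ℕ, StrictMono φ →
    ∀ F' : Set (ℕ → X), MaximalSelfStable p (r ∘ φ) F' →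
      (∀ x ∈ F, x ∘ φ ∈ F') →
      ∀ y ∈ F', ∃ x ∈ F,
        Tendsto (fun k => dist (x (φ k)) (y k) / r (φ k)) atTop (𝓝 0)

/-- `δ_p(w,x,y,z) = max_i d(x_i, p)`. -/
noncomputable def delta4 (p w x y z : X) : ℝ :=
  max (dist w p) (max (dist x p) (max (dist y p) (dist z p)))

/-- `δ_p(x,y,z) = max_i d(x_i, p)`. -/
noncomputable def delta3 (p x y z : X) : ℝ :=
  max (dist x p) (max (dist y p) (dist z p))

open Classical in
/-- The function `A₁` of Berg–Nikolaev type. -/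
noncomputable def A1 (p w x y z : X) : ℝ :=
  if w = p ∧ x = p ∧ y = p ∧ z = p then 0
  else (dist w x ^ 2 + dist x y ^ 2 + dist y z ^ 2 + dist z w ^ 2
          - dist w y ^ 2 - dist x z ^ 2) / delta4 p w x y z ^ 2

open Classical in
/-- The function `A₂` of Lebedeva–Petrunin type. -/
noncomputable def A2 (p w x y z : X) : ℝ :=
  if w = p ∧ x = p ∧ y = p ∧ z = p then 0
  else (dist w x ^ 2 + dist w y ^ 2 + dist w z ^ 2
          - (dist x y ^ 2 + dist y z ^ 2 + dist z x ^ 2) / 3) / delta4 p w x y z ^ 2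

open Classical in
/-- The function `A₃` of Ptolemy type. -/
noncomputable def A3 (p w x y z : X) : ℝ :=
  if w = p ∧ x = p ∧ y = p ∧ z = p then 0
  else (dist x w * dist y z + dist x z * dist y w - dist x y * dist w z)
          / delta4 p w x y z ^ 2

open Classical in
/-- The quotient `|d(w,z) - d(x,y)/2| / δ_p(x,y)`, valued in `EReal`, with the
conventions: `0` if `x = y = p` and `z = p`, and `+∞` if `x = y = p` but `z ≠ p`. -/
noncomputable def midQuot (p w x y z : X) : EReal :=
  if x = p ∧ y = p then (if z = p then (0 : EReal) else ⊤)
  else ((|dist w z - dist x y / 2| / max (dist x p) (dist y p) : ℝ) : EReal)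

/-- `z` is an infinitesimal midpoint of the sequences `x` and `y`. -/
def IsInfinitesimalMidpoint (p : X) (x y z : ℕ → X) : Prop :=
  Tendsto (fun n => midQuot p (x n) (x n) (y n) (z n)) atTop (𝓝 (0 : EReal)) ∧
    Tendsto (fun n => midQuot p (y n) (x n) (y n) (z n)) atTop (𝓝 (0 : EReal))

/-- `X` is midpoint convex at the marked point `p`. -/
def MidpointConvexAt (p : X) : Prop :=
  ∀ x y : ℕ → X, Tendsto x atTop (𝓝 p) → Tendsto y atTop (𝓝 p) →
    ∃ z : ℕ → X, IsInfinitesimalMidpoint p x y z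

/-- `X` is Busemann convex at the marked point `p`. -/
def BusemannConvexAt (p : X) : Prop :=
  MidpointConvexAt p ∧
    ∀ x0 x1 y m : ℕ → X, Tendsto x0 atTop (𝓝 p) → Tendsto x1 atTop (𝓝 p) →
      Tendsto y atTop (𝓝 p) → IsInfinitesimalMidpoint p x0 x1 m →
      Tendsto (fun n =>
          max (dist (m n) (y n) - (dist (x0 n) (y n) + dist (x1 n) (y n)) / 2) 0
            / delta3 p (x0 n) (y n) (x1 n)) atTop (𝓝 (0 : ℝ))

end Defs

section MetricDefs

/-- `s` is a geodesic segment with endpoints `x` and `y`: a subset isometric to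
the closed interval `[0, d(x,y)]`, the endpoints of the interval corresponding
to `x` and `y`. -/
def IsGeodesicSegment {Z : Type u} [MetricSpace Z] (s : Set Z) (x y : Z) : Prop :=
  ∃ f : ℝ → Z,
    (∀ a ∈ Set.Icc 0 (dist x y), ∀ b ∈ Set.Icc 0 (dist x y),
      dist (f a) (f b) = |a - b|) ∧
    f '' Set.Icc 0 (dist x y) = s ∧ f 0 = x ∧ f (dist x y) = y

/-- A metric space is geodesic if any two points are the endpoints of some
geodesic segment. -/
def IsGeodesicSpace (Y : Type u) [MetricSpace Y] : Prop :=
  ∀ x y : Y, ∃ s : Set Y, IsGeodesicSegment s x y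

/-- `m` is a midpoint of `x` and `y`. -/
def IsMidpointOf {Z : Type u} [MetricSpace Z] (m x y : Z) : Prop :=
  dist m x = dist x y / 2 ∧ dist m y = dist x y / 2

/-- An affinely parametrized geodesic `γ : [a,b] → Z`:
`d(γ s, γ t) = λ |s - t|` for some constant `λ ≥ 0`. -/
def IsAffineGeodesic {Z : Type u} [MetricSpace Z] (γ : ℝ → Z) (a b : ℝ) : Prop :=
  ∃ lam : ℝ, 0 ≤ lam ∧ ∀ s ∈ Set.Icc a b, ∀ t ∈ Set.Icc a b,
    dist (γ s) (γ t) = lam * |s - t|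

/-- Busemann convexity of a (geodesic) metric space: for any two affinely
parametrized geodesics the joint distance function is convex. -/
def BusemannConvex (Y : Type u) [MetricSpace Y] : Prop :=
  ∀ (a b a' b' : ℝ) (γ γ' : ℝ → Y), IsAffineGeodesic γ a b →
    IsAffineGeodesic γ' a' b' →
    ConvexOn ℝ (Set.Icc a b ×ˢ Set.Icc a' b')
      (fun q : ℝ × ℝ => dist (γ q.1) (γ' q.2))

/-- A metric space is Ptolemaic if the Ptolemy inequality holds. -/
def Ptolemaic (Y : Type u) [MetricSpace Y] : Prop :=
  ∀ x y u v : Y, dist x y * dist u v ≤ dist x u * dist y v + dist x v * dist y u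

end MetricDefs

/-! ### Helper lemmas -/

theorem exists_maximalSelfStable {X : Type u} [MetricSpace X] (p : X) (r : ℕ → ℝ)
    (S : Set (ℕ → X)) (hS : SelfStable r S) (hp : (fun _ => p) ∈ S) :
    ∃ F, S ⊆ F ∧ MaximalSelfStable p r F := by
  obtain ⟨F, hSF, hF⟩ := zorn_subset_nonempty {F : Set (ℕ → X) | SelfStable r F} (by
    intro c hc hchain _
    refine ⟨⋃₀ c, ?_, fun s hs => Set.subset_sUnion_of_mem hs⟩
    rintro x ⟨A, hA, hxA⟩ y ⟨B, hB, hyB⟩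
    rcases hchain.total hA hB with hAB | hBA
    · exact hc hB x (hAB hxA) y hyB
    · exact hc hA x hxA y (hBA hyB)) S hS
  refine ⟨F, hSF, hF.prop, hSF hp, fun G hG hFG => ?_⟩
  exact Set.Subset.antisymm (hF.le_of_ge hG hFG) hFG

theorem exists_metric_quotient (T : Type u) (D : T → T → ℝ) (h0 : ∀ x, D x x = 0)
    (hc : ∀ x y, D x y = D y x) (ht : ∀ x y z, D x z ≤ D x y + D y z) :
    ∃ (Ω : Type u) (_ : MetricSpace Ω) (q : T → Ω), Function.Surjective q ∧
      ∀ x y, dist (q x) (q y) = D x y := by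
  let _ : PseudoMetricSpace T :=
    { dist := D, dist_self := h0, dist_comm := hc, dist_triangle := ht }
  exact ⟨SeparationQuotient T, inferInstance, SeparationQuotient.mk,
    SeparationQuotient.surjective_mk, fun x y => SeparationQuotient.dist_mk x y⟩

theorem exists_pretangent {X : Type u} [MetricSpace X] (p : X) (r : ℕ → ℝ)
    (hr : IsNormalizingSeq r) (F : Set (ℕ → X)) (hF : MaximalSelfStable p r F) :
    ∃ (Ω : Type u) (_ : MetricSpace Ω) (π : (ℕ → X) → Ω), IsPretangentSpace p r F π := by
  classical
  have hstab := hF.1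
  have key : ∀ x y : F, ∃ L : ℝ,
      Tendsto (fun n => dist (x.1 n) (y.1 n) / r n) atTop (𝓝 L) :=
    fun x y => hstab x.1 x.2 y.1 y.2
  choose D hD using key
  obtain ⟨Ω, iΩ, q, hq, hqD⟩ := exists_metric_quotient F D
    (fun x => by
      refine tendsto_nhds_unique (hD x x) ?_
      simp)
    (fun x y => by
      refine tendsto_nhds_unique (hD x y) ?_
      simpa only [dist_comm] using hD y x)
    (fun x y z => by
      refine le_of_tendsto_of_tendsto' (hD x z) ((hD x y).add (hD y z)) fun n => ?_
      rw [← add_div]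
      exact div_le_div_of_nonneg_right (dist_triangle _ _ _) (hr.1 n).le)
  refine ⟨Ω, iΩ, fun x => if hx : x ∈ F then q ⟨x, hx⟩ else q ⟨_, hF.2.1⟩, hr, hF, ?_, ?_⟩
  · intro ω
    obtain ⟨x, rfl⟩ := hq ω
    exact ⟨x.1, x.2, by simp⟩
  · intro x hx y hy
    simp only [hx, hy, dif_pos, hqD]
    exact hD ⟨x, hx⟩ ⟨y, hy⟩

theorem exists_pretangent_subseq {X : Type u} [MetricSpace X] (p : X) (r : ℕ → ℝ)
    (hr : IsNormalizingSeq r) {k : ℕ} (s : Fin k → ℕ → X) (C : ℝ)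
    (hC : ∀ i n, dist (s i n) p ≤ C * r n) (i0 : Fin k) (hi0 : s i0 = fun _ => p) :
    ∃ φ : ℕ → ℕ, StrictMono φ ∧ ∃ (F : Set (ℕ → X)) (Ω : Type u) (_ : MetricSpace Ω)
      (π : (ℕ → X) → Ω), IsPretangentSpace p (r ∘ φ) F π ∧ ∀ i, s i ∘ φ ∈ F := by
  have hcomp : IsCompact (Set.Icc (fun _ => 0 : Fin k × Fin k → ℝ) (fun _ => 2 * C)) :=
    isCompact_Icc
  obtain ⟨a, -, φ, hφ, ha⟩ := hcomp.tendsto_subseq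
    (x := fun n ij => dist (s ij.1 n) (s ij.2 n) / r n) (by
      intro n
      refine ⟨fun ij => div_nonneg dist_nonneg (hr.1 n).le, fun ij => ?_⟩
      simp only
      rw [div_le_iff₀ (hr.1 n)]
      have h1 := hC ij.1 n
      have h2 := hC ij.2 n
      have h3 := dist_triangle_right (s ij.1 n) (s ij.2 n) p
      linarith)
  rw [tendsto_pi_nhds] at ha
  have hS : SelfStable (r ∘ φ) (Set.range fun i => s i ∘ φ) := by
    rintro _ ⟨i, rfl⟩ _ ⟨j, rfl⟩
    exact ⟨a (i, j), ha (i, j)⟩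
  have hp : (fun _ => p) ∈ Set.range fun i => s i ∘ φ := ⟨i0, by simp only [hi0]; rfl⟩
  obtain ⟨F, hSF, hF⟩ := exists_maximalSelfStable p (r ∘ φ) _ hS hp
  have hr' : IsNormalizingSeq (r ∘ φ) :=
    ⟨fun n => hr.1 _, hr.2.comp hφ.tendsto_atTop⟩
  obtain ⟨Ω, iΩ, π, hπ⟩ := exists_pretangent p (r ∘ φ) hr' F hF
  exact ⟨φ, hφ, F, Ω, iΩ, π, hπ, fun i => hSF ⟨i, rfl⟩⟩

theorem geodesic_midpoint {Ω : Type u} [MetricSpace Ω] (hg : IsGeodesicSpace Ω) (x y : Ω) :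
    ∃ m, dist x m = dist x y / 2 ∧ dist y m = dist x y / 2 := by
  obtain ⟨_, f, hf, -, h0, h1⟩ := hg x y
  have hL : 0 ≤ dist x y := dist_nonneg
  have m0 : (0 : ℝ) ∈ Set.Icc 0 (dist x y) := ⟨le_rfl, hL⟩
  have m1 : dist x y ∈ Set.Icc 0 (dist x y) := ⟨hL, le_rfl⟩
  have mh : dist x y / 2 ∈ Set.Icc 0 (dist x y) := ⟨by linarith, by linarith⟩
  refine ⟨f (dist x y / 2), ?_, ?_⟩
  · have := hf _ m0 _ mh
    rw [h0] at this
    rw [this, abs_of_nonpos (by linarith)]; ring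
  · have := hf _ m1 _ mh
    rw [h1] at this
    rw [this, abs_of_nonneg (by linarith)]; ring

theorem busemann_midpoint {Ω : Type u} [MetricSpace Ω] (hg : IsGeodesicSpace Ω)
    (hb : BusemannConvex Ω) (x y m z : Ω) (h1 : dist x m = dist x y / 2)
    (h2 : dist y m = dist x y / 2) : dist m z ≤ (dist x z + dist y z) / 2 := by
  obtain ⟨_, f, hf, -, f0, f1⟩ := hg x m
  obtain ⟨_, g, hgg, -, g0, g1⟩ := hg m y
  rw [dist_comm m y] at hgg g1
  rw [h1] at hf f1
  rw [h2] at hgg g1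
  obtain ⟨l, hl⟩ : ∃ l, l = dist x y / 2 := ⟨_, rfl⟩
  rw [← hl] at hf f1 hgg g1
  have hl0 : 0 ≤ l := by rw [hl]; positivity
  let γ : ℝ → Ω := fun t => if t ≤ l then f t else g (t - l)
  have cross : ∀ s ∈ Set.Icc 0 (2 * l), ∀ t ∈ Set.Icc 0 (2 * l), s ≤ l → ¬ t ≤ l →
      dist (f s) (g (t - l)) = t - s := by
    intro s hs t ht hsl htl
    push Not at htl
    have ms : s ∈ Set.Icc 0 l := ⟨hs.1, hsl⟩
    have mt : t - l ∈ Set.Icc 0 l := ⟨by linarith, by linarith [ht.2]⟩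
    have ml : l ∈ Set.Icc 0 l := ⟨hl0, le_rfl⟩
    have m0 : (0 : ℝ) ∈ Set.Icc 0 l := ⟨le_rfl, hl0⟩
    have e1 := hf s ms l ml
    have e2 := hgg 0 m0 (t - l) mt
    have e3 := hf 0 m0 s ms
    have e4 := hgg (t - l) mt l ml
    rw [f1, abs_of_nonpos (by linarith [ms.2])] at e1
    rw [g0, abs_of_nonpos (by linarith [mt.1])] at e2
    rw [f0, abs_of_nonpos (by linarith [ms.1])] at e3
    rw [g1, abs_of_nonpos (by linarith [mt.2])] at e4
    have t1 := dist_triangle (f s) m (g (t - l))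
    have t2 := dist_triangle x (f s) y
    have t3 := dist_triangle (f s) (g (t - l)) y
    apply le_antisymm <;> linarith
  have hγ : IsAffineGeodesic γ 0 (2 * l) := by
    refine ⟨1, zero_le_one, fun s hs t ht => ?_⟩
    rw [one_mul]
    simp only [γ]
    split_ifs with a b b
    · exact hf s ⟨hs.1, a⟩ t ⟨ht.1, b⟩
    · rw [cross s hs t ht a b, abs_of_nonpos (by linarith)]; ring
    · rw [dist_comm, cross t ht s hs b a, abs_of_nonneg (by linarith)]
    · push Not at a b
      rw [hgg _ ⟨by linarith, by linarith [hs.2]⟩ _ ⟨by linarith, by linarith [ht.2]⟩]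
      congr 1; ring
  have hz : IsAffineGeodesic (fun _ : ℝ => z) 0 0 := ⟨0, le_rfl, by simp⟩
  have hcv := (hb 0 (2 * l) 0 0 γ _ hγ hz).2
  have p0 : ((0 : ℝ), (0 : ℝ)) ∈ Set.Icc 0 (2 * l) ×ˢ Set.Icc (0 : ℝ) 0 := by
    constructor <;> simp [hl0]
  have p1 : (2 * l, (0 : ℝ)) ∈ Set.Icc 0 (2 * l) ×ˢ Set.Icc (0 : ℝ) 0 := by
    constructor <;> simp [hl0]
  have hc := hcv p0 p1 (show (0 : ℝ) ≤ 1 / 2 by norm_num) (show (0 : ℝ) ≤ 1 / 2 by norm_num)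
    (by norm_num)
  have γ0 : γ 0 = x := by simp [γ, hl0, f0]
  have γl : γ l = m := by simp [γ, f1]
  have γ2 : γ (2 * l) = y := by
    simp only [γ]
    split_ifs with a
    · have hl' : l = 0 := by linarith
      have e : dist x y = 0 := by linarith
      have := dist_eq_zero.1 e
      rw [hl', mul_zero, f0, this]
    · rw [← g1]; congr 1; ring
  have e : (1 / 2 : ℝ) * (2 * l) = l := by ring
  simp only [Prod.smul_mk, Prod.mk_add_mk, smul_eq_mul, mul_zero, zero_add, γ0, γ2, e, γl] at hc
  linarith

theorem midQuot_bound {X : Type u} [MetricSpace X] (p : X) (w x y z : ℕ → X)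
    (hw : ∀ n, w n = x n ∨ w n = y n)
    (h : Tendsto (fun n => midQuot p (w n) (x n) (y n) (z n)) atTop (𝓝 (0 : EReal)))
    {ε : ℝ} (hε : 0 < ε) : ∀ᶠ n in atTop,
      |dist (w n) (z n) - dist (x n) (y n) / 2| ≤ ε * max (dist (x n) p) (dist (y n) p) := by
  have he : (0 : EReal) < (ε : EReal) := by exact_mod_cast hε
  filter_upwards [h.eventually_lt_const he] with n hn
  unfold midQuot at hn
  split_ifs at hn with h1 h2
  · rcases hw n with hw | hw <;> simp [hw, h1.1, h1.2, h2]
  · exact absurd hn (by simp)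
  · have hpos : 0 < max (dist (x n) p) (dist (y n) p) := by
      rw [lt_max_iff, dist_pos, dist_pos]
      tauto
    rw [EReal.coe_lt_coe_iff, div_lt_iff₀ hpos] at hn
    exact hn.le

theorem midpointConvexAt_of_geodesic {X : Type u} [MetricSpace X] (p : X)
    (h : ∀ (r : ℕ → ℝ) (F : Set (ℕ → X)) (Ω : Type u) [MetricSpace Ω]
      (π : (ℕ → X) → Ω), IsPretangentSpace p r F π → IsGeodesicSpace Ω) :
    MidpointConvexAt p := by
  classical
  intro x y hx hy
  let δ : ℕ → ℝ := fun n => max (dist (x n) p) (dist (y n) p)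
  let E : ℕ → X → ℝ := fun n z => max (|dist (x n) z - dist (x n) (y n) / 2| / δ n)
    (|dist (y n) z - dist (x n) (y n) / 2| / δ n)
  have hδ0 : ∀ n, 0 ≤ δ n := fun n => le_max_of_le_left dist_nonneg
  have hδ : Tendsto δ atTop (𝓝 0) := by
    have := (tendsto_iff_dist_tendsto_zero.1 hx).max (tendsto_iff_dist_tendsto_zero.1 hy)
    simpa using this
  have hE0 : ∀ n z, 0 ≤ E n z := fun n z =>
    le_max_of_le_left (div_nonneg (abs_nonneg _) (hδ0 n))
  have hbdd : ∀ n, BddBelow (Set.range (E n)) := fun n =>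
    ⟨0, by rintro _ ⟨z, rfl⟩; exact hE0 n z⟩
  have hdeg : ∀ n, (x n = p ∧ y n = p) → δ n = 0 := by
    rintro n ⟨h1, h2⟩
    simp [δ, h1, h2]
  have hch : ∀ n : ℕ, ∃ z : X, (x n = p ∧ y n = p → z = p) ∧
      ∀ z', E n z ≤ E n z' + 1 / ((n : ℝ) + 1) := by
    intro n
    have hn : (0 : ℝ) < 1 / ((n : ℝ) + 1) := by positivity
    by_cases hd : x n = p ∧ y n = p
    · refine ⟨p, fun _ => rfl, fun z' => ?_⟩
      have : E n p = 0 := by simp [E, hdeg n hd]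
      rw [this]
      linarith [hE0 n z']
    · have : Nonempty X := ⟨p⟩
      obtain ⟨z, hz⟩ := exists_lt_of_ciInf_lt (lt_add_of_pos_right (⨅ z, E n z) hn)
      exact ⟨z, fun h => absurd h hd, fun z' => by linarith [ciInf_le (hbdd n) z']⟩
  choose z hz1 hz2 using hch
  have hmain : Tendsto (fun n => E n (z n)) atTop (𝓝 0) := by
    by_contra hnot
    have : ∃ ε > 0, ∃ᶠ n in atTop, ε ≤ E n (z n) := by
      by_contra hcon
      push Not at hcon
      apply hnot
      rw [Metric.tendsto_nhds]
      intro ε hε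
      filter_upwards [hcon ε hε] with n hn
      rw [Real.dist_eq, sub_zero, abs_of_nonneg (hE0 _ _)]
      exact hn
    obtain ⟨ε, hε, hfr⟩ := this
    obtain ⟨φ, hφ, hφE⟩ := extraction_of_frequently_atTop hfr
    have hδpos : ∀ n, 0 < δ (φ n) := by
      intro n
      refine lt_of_le_of_ne (hδ0 _) fun h0 => ?_
      have := hφE n
      have h' : E (φ n) (z (φ n)) = 0 := by simp [E, ← h0]
      linarith
    obtain ⟨ψ, hψ, F, Ω, iΩ, π, hπ, hF⟩ := exists_pretangent_subseq p (δ ∘ φ)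
      ⟨hδpos, hδ.comp hφ.tendsto_atTop⟩ ![x ∘ φ, y ∘ φ, fun _ => p] 1 (by
        intro i n
        have := (hδpos n).le
        fin_cases i
        · simp [δ]
        · simp [δ]
        · simpa using this) 2 rfl
    have hxF : (x ∘ φ) ∘ ψ ∈ F := hF 0
    have hyF : (y ∘ φ) ∘ ψ ∈ F := hF 1
    obtain ⟨m, hm1, hm2⟩ := geodesic_midpoint (h _ _ _ _ hπ) (π ((x ∘ φ) ∘ ψ)) (π ((y ∘ φ) ∘ ψ))
    obtain ⟨_, _, hsurj, hlim⟩ := hπ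
    obtain ⟨w, hwF, rfl⟩ := hsurj m
    have lxy := hlim _ hxF _ hyF
    have lxw := hlim _ hxF _ hwF
    have lyw := hlim _ hyF _ hwF
    have key : Tendsto (fun n => E (φ (ψ n)) (w n)) atTop (𝓝 0) := by
      have l1 := (lxw.sub (lxy.div_const 2)).abs
      have l2 := (lyw.sub (lxy.div_const 2)).abs
      have l3 := l1.max l2
      rw [hm1, hm2] at l3
      simp only [sub_self, abs_zero, max_self] at l3
      refine l3.congr fun n => ?_
      have hp := hδpos (ψ n)
      simp only [E, Function.comp]
      congr 1
      · rw [← abs_of_pos hp, ← abs_div, abs_of_pos hp]; congr 1; ring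
      · rw [← abs_of_pos hp, ← abs_div, abs_of_pos hp]; congr 1; ring
    have l4 : Tendsto (fun n => 1 / (((φ (ψ n) : ℕ) : ℝ) + 1)) atTop (𝓝 0) :=
      (tendsto_one_div_add_atTop_nhds_zero_nat (𝕜 := ℝ)).comp
        (hφ.tendsto_atTop.comp hψ.tendsto_atTop)
    have l5 := key.add l4
    have : ε ≤ 0 + 0 := ge_of_tendsto' l5 fun n =>
      (hφE (ψ n)).trans (hz2 (φ (ψ n)) (w n))
    linarith
  have hcoe : ∀ f : ℕ → ℝ, Tendsto f atTop (𝓝 0) →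
      Tendsto (fun n => ((f n : ℝ) : EReal)) atTop (𝓝 (0 : EReal)) := fun f hf =>
    (continuous_coe_real_ereal.tendsto (0 : ℝ)).comp hf
  refine ⟨z, ?_, ?_⟩
  · have : Tendsto (fun n => |dist (x n) (z n) - dist (x n) (y n) / 2| / δ n) atTop (𝓝 0) :=
      squeeze_zero (fun n => div_nonneg (abs_nonneg _) (hδ0 n)) (fun n => le_max_left _ _) hmain
    refine (hcoe _ this).congr fun n => ?_
    unfold midQuot
    split_ifs with h1 h2
    · simp [hdeg n h1]
    · exact absurd (hz1 n h1) h2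
    · rfl
  · have : Tendsto (fun n => |dist (y n) (z n) - dist (x n) (y n) / 2| / δ n) atTop (𝓝 0) :=
      squeeze_zero (fun n => div_nonneg (abs_nonneg _) (hδ0 n)) (fun n => le_max_right _ _) hmain
    refine (hcoe _ this).congr fun n => ?_
    unfold midQuot
    split_ifs with h1 h2
    · simp [hdeg n h1]
    · exact absurd (hz1 n h1) h2
    · rfl

theorem busemannConvexAt_of_pretangent {X : Type u} [MetricSpace X] (p : X)
    (h : ∀ (r : ℕ → ℝ) (F : Set (ℕ → X)) (Ω : Type u) [MetricSpace Ω]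
      (π : (ℕ → X) → Ω), IsPretangentSpace p r F π → IsGeodesicSpace Ω ∧ BusemannConvex Ω) :
    BusemannConvexAt p := by
  refine ⟨midpointConvexAt_of_geodesic p fun r F Ω _ π hπ => (h r F Ω π hπ).1, ?_⟩
  intro x0 x1 y m hx0 hx1 hy hm
  let δ : ℕ → ℝ := fun n => delta3 p (x0 n) (y n) (x1 n)
  let Q : ℕ → ℝ := fun n =>
    max (dist (m n) (y n) - (dist (x0 n) (y n) + dist (x1 n) (y n)) / 2) 0 / δ n
  have hb0 : ∀ n, dist (x0 n) p ≤ δ n := fun n => le_max_left _ _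
  have hby : ∀ n, dist (y n) p ≤ δ n := fun n => le_max_of_le_right (le_max_left _ _)
  have hb1 : ∀ n, dist (x1 n) p ≤ δ n := fun n => le_max_of_le_right (le_max_right _ _)
  have hδ0 : ∀ n, 0 ≤ δ n := fun n => dist_nonneg.trans (hb0 n)
  have hQ0 : ∀ n, 0 ≤ Q n := fun n => div_nonneg (le_max_right _ _) (hδ0 n)
  have hδ : Tendsto δ atTop (𝓝 0) := by
    have := (tendsto_iff_dist_tendsto_zero.1 hx0).max
      ((tendsto_iff_dist_tendsto_zero.1 hy).max (tendsto_iff_dist_tendsto_zero.1 hx1))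
    simp only [max_self] at this
    exact this
  have hm0 : ∀ ε > 0, ∀ᶠ n in atTop,
      |dist (x0 n) (m n) - dist (x0 n) (x1 n) / 2| ≤ ε * δ n := fun ε hε => by
    filter_upwards [midQuot_bound p x0 x0 x1 m (fun _ => Or.inl rfl) hm.1 hε] with n hn
    exact hn.trans (mul_le_mul_of_nonneg_left (max_le (hb0 n) (hb1 n)) hε.le)
  have hm1 : ∀ ε > 0, ∀ᶠ n in atTop,
      |dist (x1 n) (m n) - dist (x0 n) (x1 n) / 2| ≤ ε * δ n := fun ε hε => by
    filter_upwards [midQuot_bound p x1 x0 x1 m (fun _ => Or.inr rfl) hm.2 hε] with n hn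
    exact hn.trans (mul_le_mul_of_nonneg_left (max_le (hb0 n) (hb1 n)) hε.le)
  change Tendsto Q atTop (𝓝 0)
  by_contra hnot
  have : ∃ ε > 0, ∃ᶠ n in atTop, ε ≤ Q n := by
    by_contra hcon
    push Not at hcon
    apply hnot
    rw [Metric.tendsto_nhds]
    intro ε hε
    filter_upwards [hcon ε hε] with n hn
    rw [Real.dist_eq, sub_zero, abs_of_nonneg (hQ0 _)]
    exact hn
  obtain ⟨ε, hε, hfr⟩ := this
  obtain ⟨φ, hφ, hφQ⟩ := extraction_of_frequently_atTop (hfr.and_eventually (hm0 1 one_pos))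
  have hδpos : ∀ n, 0 < δ (φ n) := by
    intro n
    refine lt_of_le_of_ne (hδ0 _) fun h0 => ?_
    have := (hφQ n).1
    have h' : Q (φ n) = 0 := by simp [Q, ← h0]
    linarith
  obtain ⟨ψ, hψ, F, Ω, iΩ, π, hπ, hF⟩ := exists_pretangent_subseq p (δ ∘ φ)
    ⟨hδpos, hδ.comp hφ.tendsto_atTop⟩ ![x0 ∘ φ, x1 ∘ φ, y ∘ φ, m ∘ φ, fun _ => p] 3 (by
      intro i n
      have hp := hδ0 (φ n)
      have a0 := hb0 (φ n)
      have a1 := hb1 (φ n)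
      have ay := hby (φ n)
      have am : dist (m (φ n)) p ≤ 3 * δ (φ n) := by
        have b1 := (abs_le.1 (hφQ n).2).2
        have b2 := dist_triangle_left (m (φ n)) p (x0 (φ n))
        have b3 := dist_triangle_right (x0 (φ n)) (x1 (φ n)) p
        linarith
      fin_cases i
      · change dist (x0 (φ n)) p ≤ 3 * δ (φ n); linarith
      · change dist (x1 (φ n)) p ≤ 3 * δ (φ n); linarith
      · change dist (y (φ n)) p ≤ 3 * δ (φ n); linarith
      · exact am
      · change dist p p ≤ 3 * δ (φ n); rw [dist_self]; linarith) 4 rfl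
  have h0F : (x0 ∘ φ) ∘ ψ ∈ F := hF 0
  have h1F : (x1 ∘ φ) ∘ ψ ∈ F := hF 1
  have hyF : (y ∘ φ) ∘ ψ ∈ F := hF 2
  have hmF : (m ∘ φ) ∘ ψ ∈ F := hF 3
  obtain ⟨hg, hb⟩ := h _ _ _ _ hπ
  obtain ⟨_, _, -, hlim⟩ := hπ
  have hsub : Tendsto (fun n => φ (ψ n)) atTop atTop :=
    hφ.tendsto_atTop.comp hψ.tendsto_atTop
  have aux : ∀ w : ℕ → X, (w ∘ φ) ∘ ψ ∈ F → (∀ ε > 0, ∀ᶠ n in atTop,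
      |dist (w n) (m n) - dist (x0 n) (x1 n) / 2| ≤ ε * δ n) →
      dist (π ((w ∘ φ) ∘ ψ)) (π ((m ∘ φ) ∘ ψ))
        = dist (π ((x0 ∘ φ) ∘ ψ)) (π ((x1 ∘ φ) ∘ ψ)) / 2 := by
    intro w hw hwm
    have l1 := ((hlim _ hw _ hmF).sub ((hlim _ h0F _ h1F).div_const 2)).abs
    rw [← sub_eq_zero, ← abs_nonpos_iff]
    refine le_of_forall_pos_le_add fun e he => ?_
    rw [zero_add]
    refine le_of_tendsto l1 ?_
    filter_upwards [hsub.eventually (hwm e he)] with n hn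
    have hp := hδpos (ψ n)
    rw [← div_le_iff₀ hp] at hn
    refine le_of_eq_of_le ?_ hn
    simp only [Function.comp]
    rw [← abs_of_pos hp, ← abs_div, abs_of_pos hp]; congr 1; ring
  have hfin := busemann_midpoint hg hb _ _ _ (π ((y ∘ φ) ∘ ψ)) (aux x0 h0F hm0) (aux x1 h1F hm1)
  have l := (hlim _ hmF _ hyF).sub
    (((hlim _ h0F _ hyF).add (hlim _ h1F _ hyF)).div_const 2)
  have := ge_of_tendsto' l (b := ε) fun n => by
    have hp := hδpos (ψ n)
    have hq := (hφQ (ψ n)).1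
    simp only [Q] at hq
    rw [le_div_iff₀ hp, le_max_iff] at hq
    rcases hq with hq | hq
    · rw [← le_div_iff₀ hp] at hq
      refine hq.trans_eq ?_
      simp only [Function.comp]
      ring
    · exact absurd hq (not_le.2 (mul_pos hε hp))
  linarith

theorem A3_eventually {X : Type u} [MetricSpace X] (p : X)
    (h : ∀ (r : ℕ → ℝ) (F : Set (ℕ → X)) (Ω : Type u) [MetricSpace Ω]
      (π : (ℕ → X) → Ω), IsPretangentSpace p r F π → Ptolemaic Ω) {ε : ℝ} (hε : 0 < ε) :
    ∀ᶠ q : X × X × X × X in 𝓝 (p, p, p, p), -ε ≤ A3 p q.1 q.2.1 q.2.2.1 q.2.2.2 := by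
  by_contra hcon
  rw [not_eventually] at hcon
  obtain ⟨q, hq, hqA⟩ := exists_seq_forall_of_frequently hcon
  obtain ⟨w, hw⟩ : ∃ w : ℕ → X, w = fun n => (q n).1 := ⟨_, rfl⟩
  obtain ⟨x, hx⟩ : ∃ x : ℕ → X, x = fun n => (q n).2.1 := ⟨_, rfl⟩
  obtain ⟨y, hy⟩ : ∃ y : ℕ → X, y = fun n => (q n).2.2.1 := ⟨_, rfl⟩
  obtain ⟨z, hz⟩ : ∃ z : ℕ → X, z = fun n => (q n).2.2.2 := ⟨_, rfl⟩
  have tw : Tendsto w atTop (𝓝 p) := by rw [hw]; exact hq.fst_nhds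
  have tx : Tendsto x atTop (𝓝 p) := by rw [hx]; exact hq.snd_nhds.fst_nhds
  have ty : Tendsto y atTop (𝓝 p) := by rw [hy]; exact hq.snd_nhds.snd_nhds.fst_nhds
  have tz : Tendsto z atTop (𝓝 p) := by rw [hz]; exact hq.snd_nhds.snd_nhds.snd_nhds
  have hA : ∀ n, A3 p (w n) (x n) (y n) (z n) < -ε := fun n => by
    rw [hw, hx, hy, hz]; exact not_le.1 (hqA n)
  let δ : ℕ → ℝ := fun n => delta4 p (w n) (x n) (y n) (z n)
  have bw : ∀ n, dist (w n) p ≤ δ n := fun n => le_max_left _ _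
  have bx : ∀ n, dist (x n) p ≤ δ n := fun n => le_max_of_le_right (le_max_left _ _)
  have bY : ∀ n, dist (y n) p ≤ δ n := fun n =>
    le_max_of_le_right (le_max_of_le_right (le_max_left _ _))
  have bz : ∀ n, dist (z n) p ≤ δ n := fun n =>
    le_max_of_le_right (le_max_of_le_right (le_max_right _ _))
  have hδ : Tendsto δ atTop (𝓝 0) := by
    have := (tendsto_iff_dist_tendsto_zero.1 tw).max ((tendsto_iff_dist_tendsto_zero.1 tx).max
      ((tendsto_iff_dist_tendsto_zero.1 ty).max (tendsto_iff_dist_tendsto_zero.1 tz)))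
    simp only [max_self] at this
    exact this
  have hnd : ∀ n, ¬ (w n = p ∧ x n = p ∧ y n = p ∧ z n = p) := fun n hn => by
    have := hA n
    unfold A3 at this
    rw [if_pos hn] at this
    linarith
  have hδpos : ∀ n, 0 < δ n := by
    intro n
    by_contra h0
    push Not at h0
    exact hnd n ⟨dist_le_zero.1 ((bw n).trans h0), dist_le_zero.1 ((bx n).trans h0),
      dist_le_zero.1 ((bY n).trans h0), dist_le_zero.1 ((bz n).trans h0)⟩
  obtain ⟨ψ, hψ, F, Ω, iΩ, π, hπ, hF⟩ := exists_pretangent_subseq p δ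
    ⟨hδpos, hδ⟩ ![w, x, y, z, fun _ => p] 1 (by
      intro i n
      rw [one_mul]
      fin_cases i
      · exact bw n
      · exact bx n
      · exact bY n
      · exact bz n
      · change dist p p ≤ δ n; rw [dist_self]; exact (hδpos n).le) 4 rfl
  have wF : w ∘ ψ ∈ F := hF 0
  have xF : x ∘ ψ ∈ F := hF 1
  have yF : y ∘ ψ ∈ F := hF 2
  have zF : z ∘ ψ ∈ F := hF 3
  have hP := h _ _ _ _ hπ (π (x ∘ ψ)) (π (y ∘ ψ)) (π (w ∘ ψ)) (π (z ∘ ψ))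
  obtain ⟨_, _, -, hlim⟩ := hπ
  have l := (((hlim _ xF _ wF).mul (hlim _ yF _ zF)).add
    ((hlim _ xF _ zF).mul (hlim _ yF _ wF))).sub ((hlim _ xF _ yF).mul (hlim _ wF _ zF))
  have := le_of_tendsto' l (b := -ε) fun n => by
    have ha := hA (ψ n)
    unfold A3 at ha
    rw [if_neg (hnd _)] at ha
    refine le_of_eq_of_le ?_ ha.le
    change _ = _ / δ (ψ n) ^ 2
    have hp := (hδpos (ψ n)).ne'
    simp only [Function.comp]
    field_simp
  linarith

theorem A3_le {X : Type u} [MetricSpace X] (p w x y z : X) : A3 p w x y z ≤ 8 := by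
  unfold A3
  split_ifs with h0
  · norm_num
  · obtain ⟨δ, hδ⟩ : ∃ δ, δ = delta4 p w x y z := ⟨_, rfl⟩
    have bw : dist w p ≤ δ := hδ ▸ le_max_left _ _
    have bx : dist x p ≤ δ := hδ ▸ le_max_of_le_right (le_max_left _ _)
    have bY : dist y p ≤ δ := hδ ▸ le_max_of_le_right (le_max_of_le_right (le_max_left _ _))
    have bz : dist z p ≤ δ := hδ ▸ le_max_of_le_right (le_max_of_le_right (le_max_right _ _))
    have h2 : ∀ a b : X, dist a p ≤ δ → dist b p ≤ δ → dist a b ≤ 2 * δ := fun a b ha hb => by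
      linarith [dist_triangle_right a b p]
    rw [← hδ]
    have hδ0 : 0 ≤ δ := dist_nonneg.trans bw
    refine div_le_of_le_mul₀ (by positivity) (by norm_num) ?_
    have m1 := mul_le_mul (h2 x w bx bw) (h2 y z bY bz) dist_nonneg (by positivity)
    have m2 := mul_le_mul (h2 x z bx bz) (h2 y w bY bw) dist_nonneg (by positivity)
    have m3 : 0 ≤ dist x y * dist w z := by positivity
    nlinarith

/-- if every pretangent space is a Ptolemaic, Busemann convex
geodesic metric space (i.e. CAT(0)), then `X` is Busemann convex at `p` and
`liminf_{w,x,y,z → p} A₃ ≥ 0`. -/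
theorem busemannConvexAt_and_liminf_A3_of_pretangent_CAT0
    {X : Type u} [MetricSpace X] (p : X)
    (h : ∀ (r : ℕ → ℝ) (F : Set (ℕ → X)) (Ω : Type u) [MetricSpace Ω]
      (π : (ℕ → X) → Ω), IsPretangentSpace p r F π →
      Ptolemaic Ω ∧ IsGeodesicSpace Ω ∧ BusemannConvex Ω) :
    BusemannConvexAt p ∧
      0 ≤ liminf (fun q : X × X × X × X => A3 p q.1 q.2.1 q.2.2.1 q.2.2.2)
          (𝓝 (p, p, p, p)) := by
  refine ⟨busemannConvexAt_of_pretangent p fun r F Ω _ π hπ => (h r F Ω π hπ).2, ?_⟩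
  refine le_of_forall_pos_le_add fun ε hε => ?_
  have hcob : IsCoboundedUnder (· ≥ ·) (𝓝 (p, p, p, p))
      (fun q : X × X × X × X => A3 p q.1 q.2.1 q.2.2.1 q.2.2.2) :=
    IsBoundedUnder.isCoboundedUnder_ge ⟨8, by
      rw [eventually_map]
      exact Eventually.of_forall fun q => A3_le _ _ _ _ _⟩
  have := le_liminf_of_le hcob
    (A3_eventually p (fun r F Ω _ π hπ => (h r F Ω π hπ).1) hε)
  linarith
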